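/- Let D ∈ F_p be a nonsquare, M = [[X,Y],[Z,W]] ∈ SL₂(F_p), F := (W² − D Z²)^{−1}, ψ_F the nontrivial additive character ψ_F(x) = ψ(F x), and α(i,x) := Λ(W² − D Z²)·ψ(F·(Y W − D X Z)·(x² − i²)). For t ∈ F_p^× let B(t) := [[(1+D t²)/(1−D t²), 2 t D/(1−D t²)],[2 t/(1−D t²), (1+D t²)/(1−D t²)]] ∈ SL₂(F_p), whose conjugate M B(t) M^{−1} has nonzero lower-left entry. Then for all i, x ∈ F_p: Σ_{t ∈ F_p^×} conj(ν((1+t u)/(1−t u))) · (T_{M B(t) M^{−1}} δ_i)(x) = α(i,x) · G · E'_ν(i,x)/√p, where E'_ν(i,x) denotes the exponential sum E_ν(i,x) formed with the character ψ_F in place of ψ. -/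

import Mathlib

open Finset

open Classical in
/-- The quadratic character of `F_p`, with values in `ℂ`. -/
noncomputable def quadChar (p : ℕ) (t : ZMod p) : ℂ :=
  if t = 0 then 0 else if IsSquare t then 1 else -1

/-- The normalized Gauss sum `G = p^{-1/2} ∑_y ψ(y²)`. -/
noncomputable def gaussSum' (p : ℕ) [NeZero p] (ψ : AddChar (ZMod p) ℂ) : ℂ :=
  (Real.sqrt p : ℂ)⁻¹ * ∑ y : ZMod p, ψ (y ^ 2)

/-- The delta function at `i`. -/
noncomputable def deltaF (p : ℕ) (i : ZMod p) : ZMod p → ℂ :=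
  fun x => if x = i then 1 else 0

/-- The Weil-representation operator `T_M` for `M = [[a,b],[c,d]]` with `c ≠ 0`. -/
noncomputable def WeilOp (p : ℕ) [Fact p.Prime] (ψ : AddChar (ZMod p) ℂ)
    (M : Matrix (Fin 2) (Fin 2) (ZMod p)) (f : ZMod p → ℂ) : ZMod p → ℂ :=
  fun x => gaussSum' p ψ / Real.sqrt p * quadChar p (-(M 1 0)) *
    ∑ i : ZMod p, ψ ((M 0 0 * x ^ 2 + M 1 1 * i ^ 2 - 2 * x * i) / M 1 0) * f i


/-- The exponential sum `E_ν(i,x)` attached to a character `ν` of the norm-one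
group of the quadratic extension `K/F_p`, formed with the additive character
`χ`. -/
noncomputable def Esum (p : ℕ) [Fact p.Prime] (χ : AddChar (ZMod p) ℂ)
    (D : ZMod p) {K : Type} [Field K] [Algebra (ZMod p) K] (u : K)
    (ν : K → ℂ) (i x : ZMod p) : ℂ :=
  ∑ t ∈ (Finset.univ : Finset (ZMod p)).erase 0,
    (starRingEnd ℂ) (ν ((1 + algebraMap (ZMod p) K t * u) /
        (1 - algebraMap (ZMod p) K t * u))) *
      quadChar p (-2 * t / (1 - D * t ^ 2)) *
      χ ((x - i) ^ 2 / (2 * t) + D * t * (x + i) ^ 2 / 2)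

theorem quadChar_eq_quadraticChar (p : ℕ) [Fact p.Prime] (a : ZMod p) :
    quadChar p a = (quadraticChar (ZMod p) a : ℂ) := by
  classical
  rw [quadraticChar_apply, quadraticCharFun, quadChar]
  split_ifs <;> simp

theorem quadChar_mul (p : ℕ) [Fact p.Prime] (a b : ZMod p) :
    quadChar p (a * b) = quadChar p a * quadChar p b := by
  simp only [quadChar_eq_quadraticChar, map_mul, Int.cast_mul]

theorem sq_sub_mul_sq_ne_zero {F : Type*} [Field F] {D : F} (hD : ¬ IsSquare D) {a b : F}
    (h : a ≠ 0 ∨ b ≠ 0) : a ^ 2 - D * b ^ 2 ≠ 0 := by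
  intro h0
  by_cases hb : b = 0
  · subst hb
    simp_all
  · refine hD ⟨a / b, ?_⟩
    field_simp
    linear_combination -h0

theorem WeilOp_deltaF (p : ℕ) [Fact p.Prime] (ψ : AddChar (ZMod p) ℂ)
    (M : Matrix (Fin 2) (Fin 2) (ZMod p)) (i x : ZMod p) :
    WeilOp p ψ M (deltaF p i) x = gaussSum' p ψ / Real.sqrt p * quadChar p (-(M 1 0)) *
      ψ ((M 0 0 * x ^ 2 + M 1 1 * i ^ 2 - 2 * x * i) / M 1 0) := by
  simp [WeilOp, deltaF]

/-- The conjugate of `[[A, S D], [S, A]]` by `[[X, Y], [Z, W]]` of determinant one. -/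
theorem conj_torus_eq {R : Type*} [CommRing R] {X Y Z W : R} (hdet : X * W - Y * Z = 1)
    (A S D B : R) (hB : B = S * D) :
    !![X, Y; Z, W] * !![A, B; S, A] * (!![X, Y; Z, W])⁻¹ =
      !![A + S * (Y * W - D * X * Z), S * (D * X ^ 2 - Y ^ 2);
         S * (W ^ 2 - D * Z ^ 2), A - S * (Y * W - D * X * Z)] := by
  subst hB
  rw [Matrix.inv_def, Matrix.det_fin_two_of, hdet, Ring.inverse_one, one_smul,
    Matrix.adjugate_fin_two_of]
  ext j k
  fin_cases j <;> fin_cases k <;> simp [Matrix.mul_apply, Fin.sum_univ_two]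
  · linear_combination A * hdet
  · ring
  · ring
  · linear_combination A * hdet

/-- Summing the Hecke-operator action on `δ_i` against the character `ν`
produces the exponential sum `E'_ν(i,x)` (formed with `ψ_F`), up to the factor
`α(i,x) G / √p`. -/
theorem hecke_projection_as_exponential_sum
    (p : ℕ) [Fact p.Prime] (hp2 : p ≠ 2)
    (ψ : AddChar (ZMod p) ℂ) (hψ : ψ ≠ 1)
    (D : ZMod p) (hD : ¬ IsSquare D)
    (X Y Z W : ZMod p) (hdet : X * W - Y * Z = 1)
    (ψF : AddChar (ZMod p) ℂ)
    (hψF : ∀ y : ZMod p, ψF y = ψ ((W ^ 2 - D * Z ^ 2)⁻¹ * y))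
    (K : Type) [Field K] [Algebra (ZMod p) K] [Fintype K]
    (hK : Fintype.card K = p ^ 2)
    (u : K) (hu : u ^ 2 = algebraMap (ZMod p) K D)
    (ν : K → ℂ)
    (hν0 : ∀ z : K, z ^ (p + 1) = 1 → ν z ≠ 0)
    (hνm : ∀ z w : K, z ^ (p + 1) = 1 → w ^ (p + 1) = 1 →
      ν (z * w) = ν z * ν w) :
    (∀ t : ZMod p, t ≠ 0 →
      ((!![X, Y; Z, W] *
          !![(1 + D * t ^ 2) / (1 - D * t ^ 2), 2 * t * D / (1 - D * t ^ 2);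
             2 * t / (1 - D * t ^ 2), (1 + D * t ^ 2) / (1 - D * t ^ 2)] *
          (!![X, Y; Z, W])⁻¹ : Matrix (Fin 2) (Fin 2) (ZMod p)) 1 0) ≠ 0) ∧
    ∀ i x : ZMod p,
      (∑ t ∈ (Finset.univ : Finset (ZMod p)).erase 0,
        (starRingEnd ℂ) (ν ((1 + algebraMap (ZMod p) K t * u) /
            (1 - algebraMap (ZMod p) K t * u))) *
          WeilOp p ψ
            (!![X, Y; Z, W] *
              !![(1 + D * t ^ 2) / (1 - D * t ^ 2), 2 * t * D / (1 - D * t ^ 2);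
                 2 * t / (1 - D * t ^ 2), (1 + D * t ^ 2) / (1 - D * t ^ 2)] *
              (!![X, Y; Z, W])⁻¹) (deltaF p i) x) =
      quadChar p (W ^ 2 - D * Z ^ 2) *
        ψ ((W ^ 2 - D * Z ^ 2)⁻¹ * (Y * W - D * X * Z) * (x ^ 2 - i ^ 2)) *
        gaussSum' p ψ * Esum p ψF D u ν i x / Real.sqrt p := by
  have h2 : (2 : ZMod p) ≠ 0 := by
    apply Ring.two_ne_zero
    rwa [ZMod.ringChar_zmod_n]
  have hN : W ^ 2 - D * Z ^ 2 ≠ 0 := by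
    refine sq_sub_mul_sq_ne_zero hD ?_
    by_contra! h
    simp [h.1, h.2] at hdet
  have hden (t : ZMod p) : 1 - D * t ^ 2 ≠ 0 := by
    simpa using sq_sub_mul_sq_ne_zero hD (a := 1) (b := t) (Or.inl one_ne_zero)
  have hconj (t : ZMod p) := conj_torus_eq hdet ((1 + D * t ^ 2) / (1 - D * t ^ 2))
    (2 * t / (1 - D * t ^ 2)) D (2 * t * D / (1 - D * t ^ 2)) (by ring)
  refine ⟨fun t ht => ?_, fun i x => ?_⟩
  · rw [hconj]
    exact mul_ne_zero (div_ne_zero (mul_ne_zero h2 ht) (hden t)) hN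
  · rw [Esum, Finset.mul_sum, Finset.sum_div]
    refine Finset.sum_congr rfl fun t ht => ?_
    have ht : t ≠ 0 := Finset.ne_of_mem_erase ht
    have hd := hden t
    rw [WeilOp_deltaF, hconj]
    simp only [Matrix.of_apply, Matrix.cons_val', Matrix.cons_val_zero, Matrix.cons_val_one,
      Matrix.cons_val_fin_one]
    have hq : -(2 * t / (1 - D * t ^ 2) * (W ^ 2 - D * Z ^ 2)) =
        (W ^ 2 - D * Z ^ 2) * (-2 * t / (1 - D * t ^ 2)) := by ring
    have he : (((1 + D * t ^ 2) / (1 - D * t ^ 2) +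
          2 * t / (1 - D * t ^ 2) * (Y * W - D * X * Z)) * x ^ 2 +
        ((1 + D * t ^ 2) / (1 - D * t ^ 2) -
          2 * t / (1 - D * t ^ 2) * (Y * W - D * X * Z)) * i ^ 2 - 2 * x * i) /
        (2 * t / (1 - D * t ^ 2) * (W ^ 2 - D * Z ^ 2)) =
        (W ^ 2 - D * Z ^ 2)⁻¹ * (Y * W - D * X * Z) * (x ^ 2 - i ^ 2) +
        (W ^ 2 - D * Z ^ 2)⁻¹ * ((x - i) ^ 2 / (2 * t) + D * t * (x + i) ^ 2 / 2) := by
      generalize W ^ 2 - D * Z ^ 2 = N at hN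
      generalize Y * W - D * X * Z = E
      field_simp
      ring
    rw [hq, he, quadChar_mul, AddChar.map_add_eq_mul, hψF]
    ring
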